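/- Let n ≥ 0 be an integer, let m ∈ {1,…,2^n}, let κ = 1 if n is even and κ = 2 if n is odd, and let c be the positive integer such that κc(c−1) ≤ m < κc(c+1). Then Φ(n,m) = √(κ·2^n)·(2c − 1 + 2·δ_{2κc}(m − κc(c−1))) − m. -/

import Mathlib

open Finset

/-- The ground set `[n] = {1, …, n}`. -/
def groundSet (n : ℕ) : Finset ℕ := Finset.Icc 1 n

/-- The up-closure `𝓕↑` of a family `F` with respect to ground set `X`. -/
def upClo (X : Finset ℕ) (F : Finset (Finset ℕ)) : Finset (Finset ℕ) :=
  X.powerset.filter (fun S => ∃ A ∈ F, A ⊆ S)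

/-- The down-closure `𝓕↓` of a family `F` with respect to ground set `X`. -/
def downClo (X : Finset ℕ) (F : Finset (Finset ℕ)) : Finset (Finset ℕ) :=
  X.powerset.filter (fun S => ∃ A ∈ F, S ⊆ A)

/-- `𝓕↕ = 𝓕↑ ∪ 𝓕↓` with respect to ground set `X`. -/
def udClo (X : Finset ℕ) (F : Finset (Finset ℕ)) : Finset (Finset ℕ) :=
  upClo X F ∪ downClo X F

/-- `Φ(n,m)`: the minimum of `|𝓕↕|` over families `𝓕 ⊆ 2^[n]` with `|𝓕| = m`,
closures taken w.r.t. the ground set `[n]`. -/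
noncomputable def Phi (n m : ℕ) : ℕ :=
  sInf {k | ∃ F : Finset (Finset ℕ),
    F ⊆ (groundSet n).powerset ∧ F.card = m ∧ (udClo (groundSet n) F).card = k}

/-- The function `δ_k` (the value for `k = 0` is junk). For `k ≥ 2`,
`δ_k(x) = δ_{⌊k/2⌋}(x)/2` if `x < ⌊k/2⌋` and
`δ_k(x) = 1/2 + δ_{⌈k/2⌉}(x - ⌊k/2⌋)/2` otherwise. -/
def delta : ℕ → ℕ → ℚ
  | 0, x => x
  | 1, x => x
  | k + 2, x =>
      if x < (k + 2) / 2 then (1 / 2) * delta ((k + 2) / 2) x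
      else 1 / 2 + (1 / 2) * delta ((k + 3) / 2) (x - (k + 2) / 2)
termination_by k _ => k
decreasing_by all_goals omega

/-- The largest possible size of `U ∩ D` for an up-set `U` of size `u` and a down-set `D` of
size `d` in the power set of an `n`-element set. -/
def crossMax : ℕ → ℕ → ℕ → ℕ
  | 0, u, d => min u d
  | n + 1, u, d => crossMax n (u / 2) (min d (2 ^ n)) + crossMax n ((u + 1) / 2) (d - 2 ^ n)

lemma crossMax_succ (n u d : ℕ) : crossMax (n + 1) u d =
    crossMax n (u / 2) (min d (2 ^ n)) + crossMax n ((u + 1) / 2) (d - 2 ^ n) := rfl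

lemma crossMax_le_left (n u d : ℕ) : crossMax n u d ≤ u := by
  induction n generalizing u d with
  | zero => exact min_le_left _ _
  | succ n ih =>
    rw [crossMax_succ]
    have h1 := ih (u / 2) (min d (2 ^ n))
    have h2 := ih ((u + 1) / 2) (d - 2 ^ n)
    omega

lemma crossMax_le_right (n u d : ℕ) : crossMax n u d ≤ d := by
  induction n generalizing u d with
  | zero => exact min_le_right _ _
  | succ n ih =>
    rw [crossMax_succ]
    have h1 := ih (u / 2) (min d (2 ^ n))
    have h2 := ih ((u + 1) / 2) (d - 2 ^ n)
    omega

lemma crossMax_zero_left (n d : ℕ) : crossMax n 0 d = 0 :=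
  Nat.le_zero.mp (crossMax_le_left n 0 d)

lemma crossMax_zero_right (n u : ℕ) : crossMax n u 0 = 0 :=
  Nat.le_zero.mp (crossMax_le_right n u 0)

lemma crossMax_mono {n u u' d d' : ℕ} (hu : u ≤ u') (hd : d ≤ d') :
    crossMax n u d ≤ crossMax n u' d' := by
  induction n generalizing u u' d d' with
  | zero => exact min_le_min hu hd
  | succ n ih => exact Nat.add_le_add (ih (by omega) (by omega)) (ih (by omega) (by omega))

lemma crossMax_add_left_le (n u d r : ℕ) : crossMax n (u + r) d ≤ crossMax n u d + r := by
  induction n generalizing u d r with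
  | zero => simp only [crossMax]; omega
  | succ n ih =>
    simp only [crossMax_succ]
    have h1 := ih (u / 2) (min d (2 ^ n)) ((u + r) / 2 - u / 2)
    have h2 := ih ((u + 1) / 2) (d - 2 ^ n) ((u + r + 1) / 2 - (u + 1) / 2)
    rw [show u / 2 + ((u + r) / 2 - u / 2) = (u + r) / 2 by omega] at h1
    rw [show (u + 1) / 2 + ((u + r + 1) / 2 - (u + 1) / 2) = (u + r + 1) / 2 by omega] at h2
    omega

lemma crossMax_pow_right {n u : ℕ} (hu : u ≤ 2 ^ n) : crossMax n u (2 ^ n) = u := by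
  induction n generalizing u with
  | zero => simpa [crossMax] using hu
  | succ n ih =>
    rw [pow_succ] at hu
    rw [crossMax_succ, show min (2 ^ (n + 1)) (2 ^ n) = 2 ^ n by rw [pow_succ]; omega,
      show 2 ^ (n + 1) - 2 ^ n = 2 ^ n by rw [pow_succ]; omega, ih (by omega), ih (by omega)]
    omega

lemma crossMax_succ' {n u d : ℕ} (hu : u ≤ 2 ^ (n + 1)) (hd : d ≤ 2 ^ (n + 1)) :
    crossMax (n + 1) u d =
      crossMax n (min u (2 ^ n)) (d / 2) + crossMax n (u - 2 ^ n) ((d + 1) / 2) := by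
  induction n generalizing u d with
  | zero =>
    simp only [crossMax]
    norm_num at hu hd ⊢
    interval_cases u <;> interval_cases d <;> rfl
  | succ n ih =>
    have h1 : 2 ^ (n + 1) = 2 * 2 ^ n := by rw [pow_succ, mul_comm]
    have h2 : 2 ^ (n + 1 + 1) = 4 * 2 ^ n := by rw [pow_succ, h1]; ring
    rw [crossMax_succ (n + 1), ih (by omega) (by omega), ih (by omega) (by omega),
      crossMax_succ n, crossMax_succ n, h1]
    rw [show min (u / 2) (2 ^ n) = min u (2 * 2 ^ n) / 2 by omega,
      show min d (2 * 2 ^ n) / 2 = min (d / 2) (2 ^ n) by omega,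
      show u / 2 - 2 ^ n = (u - 2 * 2 ^ n) / 2 by omega,
      show (min d (2 * 2 ^ n) + 1) / 2 = min ((d + 1) / 2) (2 ^ n) by omega,
      show min ((u + 1) / 2) (2 ^ n) = (min u (2 * 2 ^ n) + 1) / 2 by omega,
      show (d - 2 * 2 ^ n) / 2 = d / 2 - 2 ^ n by omega,
      show (u + 1) / 2 - 2 ^ n = (u - 2 * 2 ^ n + 1) / 2 by omega,
      show (d - 2 * 2 ^ n + 1) / 2 = (d + 1) / 2 - 2 ^ n by omega]
    omega

lemma crossMax_comm {n u d : ℕ} (hu : u ≤ 2 ^ n) (hd : d ≤ 2 ^ n) :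
    crossMax n u d = crossMax n d u := by
  induction n generalizing u d with
  | zero => exact min_comm _ _
  | succ n ih =>
    rw [crossMax_succ' hd hu, crossMax_succ]
    rw [pow_succ] at hu hd
    rw [ih (u := u / 2) (by omega) (by omega), ih (u := (u + 1) / 2) (by omega) (by omega)]

lemma crossMax_pow_left {n d : ℕ} (hd : d ≤ 2 ^ n) : crossMax n (2 ^ n) d = d := by
  rw [crossMax_comm le_rfl hd, crossMax_pow_right hd]

lemma crossMax_add_right_le {n u d r : ℕ} (hu : u ≤ 2 ^ n) (hd : d + r ≤ 2 ^ n) :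
    crossMax n u (d + r) ≤ crossMax n u d + r := by
  rw [crossMax_comm hu hd, crossMax_comm hu (by omega)]
  exact crossMax_add_left_le _ _ _ _

lemma add_le_crossMax_add {n u d : ℕ} (hu : u ≤ 2 ^ n) (hd : d ≤ 2 ^ n) :
    u + d ≤ crossMax n u d + 2 ^ n := by
  have h := crossMax_add_right_le (r := 2 ^ n - d) hu (by omega : d + (2 ^ n - d) ≤ 2 ^ n)
  rw [Nat.add_sub_cancel' hd, crossMax_pow_right hu] at h
  omega

lemma crossMax_succ_of_le {n d : ℕ} (u : ℕ) (hd : d ≤ 2 ^ n) :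
    crossMax (n + 1) u d = crossMax n (u / 2) d := by
  rw [crossMax_succ, min_eq_left hd, Nat.sub_eq_zero_of_le hd, crossMax_zero_right, add_zero]

lemma crossMax_succ_add {n u : ℕ} (d : ℕ) (hu : u ≤ 2 ^ (n + 1)) :
    crossMax (n + 1) u (2 ^ n + d) = u / 2 + crossMax n ((u + 1) / 2) d := by
  rw [pow_succ] at hu
  rw [crossMax_succ, min_eq_right (by omega), Nat.add_sub_cancel_left,
    crossMax_pow_right (by omega)]

lemma crossMax_succ_of_le' {n u d : ℕ} (hu : u ≤ 2 ^ n) (hd : d ≤ 2 ^ (n + 1)) :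
    crossMax (n + 1) u d = crossMax n u (d / 2) := by
  rw [crossMax_succ' (by rw [pow_succ]; omega) hd, min_eq_left hu, Nat.sub_eq_zero_of_le hu,
    crossMax_zero_left, add_zero]

lemma crossMax_succ_add' {n u d : ℕ} (hu : u ≤ 2 ^ n) (hd : d ≤ 2 ^ (n + 1)) :
    crossMax (n + 1) (2 ^ n + u) d = d / 2 + crossMax n u ((d + 1) / 2) := by
  rw [crossMax_succ' (by rw [pow_succ]; omega) hd, min_eq_right (by omega),
    Nat.add_sub_cancel_left, crossMax_pow_left (by rw [pow_succ] at hd; omega)]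

/-- Superadditivity when `u₀ ≤ u₁` and `d₁ ≤ d₀` both straddle the middle, in the case where
the sum of the `u` is small and the sum of the `d` is large. -/
lemma crossMax_add_le_of_le_of_gt {n a b u d : ℕ}
    (ih : ∀ {p q : ℕ}, p ≤ 2 ^ n → q ≤ 2 ^ n →
      crossMax n p q ≤ crossMax (n + 1) (p + 2 ^ n) q)
    (hb : b ≤ 2 * 2 ^ n) (hd : d ≤ 2 * 2 ^ n)
    (hau : a + u ≤ 2 * 2 ^ n) (hbd : 2 * 2 ^ n < b + d) :
    u / 2 + crossMax n ((u + 1) / 2) (b / 2) + (d / 2 + crossMax n (a / 2) ((d + 1) / 2)) ≤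
      crossMax (n + 3) (2 * 2 ^ n + a + u) (2 * 2 ^ n + b + d) := by
  obtain ⟨B, rfl⟩ : ∃ B, b = B + (2 * 2 ^ n - d) := ⟨b - (2 * 2 ^ n - d), by omega⟩
  have e1 : 2 ^ (n + 1) = 2 * 2 ^ n := by ring
  have e2 : 2 ^ (n + 2) = 4 * 2 ^ n := by ring
  have e3 : 2 ^ (n + 2 + 1) = 8 * 2 ^ n := by ring
  rw [show 2 * 2 ^ n + (B + (2 * 2 ^ n - d)) + d = 2 ^ (n + 2) + B by omega,
    crossMax_succ_add B (by omega), crossMax_succ_of_le' (by omega) (by omega)]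
  have h1 := crossMax_le_left n (a / 2) ((d + 1) / 2)
  have h2 := crossMax_add_right_le (n := n) (u := (u + 1) / 2) (d := B / 2)
    (r := (B + (2 * 2 ^ n - d)) / 2 - B / 2) (by omega) (by omega)
  rw [show B / 2 + ((B + (2 * 2 ^ n - d)) / 2 - B / 2) = (B + (2 * 2 ^ n - d)) / 2 by omega] at h2
  have h3 := ih (p := (u + 1) / 2) (q := B / 2) (by omega) (by omega)
  have h4 : crossMax (n + 1) ((u + 1) / 2 + 2 ^ n) (B / 2) ≤
      crossMax (n + 1) ((2 * 2 ^ n + a + u + 1) / 2) (B / 2) := crossMax_mono (by omega) le_rfl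
  omega

lemma crossMax_add_le_of_straddle {n a b u d : ℕ}
    (ih : ∀ {p q : ℕ}, p ≤ 2 ^ n → q ≤ 2 ^ n →
      crossMax n p q ≤ crossMax (n + 1) (p + 2 ^ n) q)
    (ha : a ≤ 2 * 2 ^ n) (hb : b ≤ 2 * 2 ^ n) (hu : u ≤ 2 * 2 ^ n) (hd : d ≤ 2 * 2 ^ n) :
    crossMax (n + 2) u (2 * 2 ^ n + b) + crossMax (n + 2) (2 * 2 ^ n + a) d ≤
      crossMax (n + 3) (2 * 2 ^ n + a + u) (2 * 2 ^ n + b + d) := by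
  have e1 : 2 ^ (n + 1) = 2 * 2 ^ n := by ring
  have e2 : 2 ^ (n + 2) = 4 * 2 ^ n := by ring
  have e2' : 2 ^ (n + 1 + 1) = 4 * 2 ^ n := by ring
  have e3 : 2 ^ (n + 3) = 8 * 2 ^ n := by ring
  have e3' : 2 ^ (n + 2 + 1) = 8 * 2 ^ n := by ring
  have l1 : crossMax (n + 2) u (2 * 2 ^ n + b) = u / 2 + crossMax n ((u + 1) / 2) (b / 2) := by
    rw [← e1, crossMax_succ_add b (by omega), crossMax_succ_of_le' (by omega) (by omega)]
  have l2 : crossMax (n + 2) (2 * 2 ^ n + a) d = d / 2 + crossMax n (a / 2) ((d + 1) / 2) := by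
    rw [← e1, crossMax_succ_add' (by omega) (by omega), crossMax_succ_of_le _ (by omega)]
  rw [l1, l2]
  have h1 := crossMax_le_right n ((u + 1) / 2) (b / 2)
  have h2 := crossMax_le_left n (a / 2) ((d + 1) / 2)
  rcases le_or_gt (a + u) (2 * 2 ^ n) with hau | hau <;>
    rcases le_or_gt (b + d) (2 * 2 ^ n) with hbd | hbd
  · rw [crossMax_succ_of_le _ (by omega), crossMax_succ_of_le' (by omega) (by omega)]
    have := add_le_crossMax_add (n := n + 1) (u := (2 * 2 ^ n + a + u) / 2)
      (d := (2 * 2 ^ n + b + d) / 2) (by omega) (by omega)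
    omega
  · exact crossMax_add_le_of_le_of_gt ih hb hd hau hbd
  · have h := crossMax_add_le_of_le_of_gt (a := b) (b := a) (u := d) (d := u) ih ha hu hbd hau
    rw [crossMax_comm (u := 2 * 2 ^ n + a + u) (by omega) (by omega),
      crossMax_comm (u := (u + 1) / 2) (by omega) (by omega),
      crossMax_comm (u := a / 2) (by omega) (by omega)]
    omega
  · obtain ⟨B, hB⟩ : ∃ B, 2 * 2 ^ n + b + d = 2 ^ (n + 2) + B :=
      ⟨b + d - 2 * 2 ^ n, by omega⟩
    rw [hB, crossMax_succ_add B (by omega)]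
    obtain ⟨A, hA⟩ : ∃ A, (2 * 2 ^ n + a + u + 1) / 2 = 2 ^ (n + 1) + A :=
      ⟨(2 * 2 ^ n + a + u + 1) / 2 - 2 * 2 ^ n, by omega⟩
    rw [hA, crossMax_succ_add' (by omega) (by omega)]
    omega

/-- Superadditivity of `crossMax` for oppositely ordered pairs. -/
theorem crossMax_add_le {n u₀ u₁ d₀ d₁ : ℕ} (hu : u₀ ≤ u₁) (hd : d₁ ≤ d₀)
    (hu₁ : u₁ ≤ 2 ^ n) (hd₀ : d₀ ≤ 2 ^ n) :
    crossMax n u₀ d₀ + crossMax n u₁ d₁ ≤ crossMax (n + 1) (u₀ + u₁) (d₀ + d₁) := by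
  induction n using Nat.strong_induction_on generalizing u₀ u₁ d₀ d₁ with
  | _ n IH =>
  rcases n with _ | n
  · simp only [crossMax]
    norm_num at hu₁ hd₀ ⊢
    interval_cases u₁ <;> interval_cases d₀ <;> omega
  have unmixed : ∀ {u₀ u₁ d₀ d₁ : ℕ}, u₀ ≤ u₁ → d₁ ≤ d₀ → u₁ ≤ 2 ^ (n + 1) → d₀ ≤ 2 ^ (n + 1) →
      d₀ ≤ 2 ^ n ∨ 2 ^ n ≤ d₁ →
      crossMax (n + 1) u₀ d₀ + crossMax (n + 1) u₁ d₁ ≤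
        crossMax (n + 2) (u₀ + u₁) (d₀ + d₁) := by
    intro u₀ u₁ d₀ d₁ hu hd hu₁ hd₀ h
    have e1 : 2 ^ (n + 1) = 2 * 2 ^ n := by ring
    have e2 : 2 ^ (n + 1 + 1) = 4 * 2 ^ n := by ring
    rcases h with h | h
    · rw [crossMax_succ_of_le _ h, crossMax_succ_of_le _ (hd.trans h),
        crossMax_succ_of_le _ (by omega)]
      exact (IH n (by omega) (by omega) hd (by omega) h).trans
        (crossMax_mono (by omega) le_rfl)
    · obtain ⟨b₀, rfl⟩ := Nat.exists_eq_add_of_le (h.trans hd)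
      obtain ⟨b₁, rfl⟩ := Nat.exists_eq_add_of_le h
      rw [crossMax_succ_add _ (by omega), crossMax_succ_add _ (by omega),
        show 2 ^ n + b₀ + (2 ^ n + b₁) = 2 ^ (n + 1) + (b₀ + b₁) by omega,
        crossMax_succ_add _ (by omega)]
      have h1 := IH n (by omega) (u₀ := (u₀ + 1) / 2) (u₁ := (u₁ + 1) / 2) (d₀ := b₀) (d₁ := b₁)
        (by omega) (by omega) (by omega) (by omega)
      have h2 := crossMax_add_left_le (n + 1) ((u₀ + u₁ + 1) / 2) (b₀ + b₁)
        ((u₀ + 1) / 2 + (u₁ + 1) / 2 - (u₀ + u₁ + 1) / 2)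
      rw [show (u₀ + u₁ + 1) / 2 + ((u₀ + 1) / 2 + (u₁ + 1) / 2 - (u₀ + u₁ + 1) / 2) =
        (u₀ + 1) / 2 + (u₁ + 1) / 2 by omega] at h2
      omega
  by_cases hdm : d₀ ≤ 2 ^ n ∨ 2 ^ n ≤ d₁
  · exact unmixed hu hd hu₁ hd₀ hdm
  by_cases hum : u₁ ≤ 2 ^ n ∨ 2 ^ n ≤ u₀
  · have h := unmixed hd hu hd₀ hu₁ hum
    have e2 : 2 ^ (n + 2) = 2 * 2 ^ (n + 1) := by ring
    rw [crossMax_comm (hu.trans hu₁) hd₀, crossMax_comm hu₁ (hd.trans hd₀),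
      crossMax_comm (n := n + 1 + 1) (by omega) (by omega), add_comm u₀, add_comm d₀,
      add_comm (crossMax _ _ _)]
    exact h
  rcases n with _ | n
  · norm_num at hu₁ hd₀ hdm hum
    obtain ⟨rfl, rfl, rfl, rfl⟩ : u₀ = 0 ∧ u₁ = 2 ∧ d₀ = 2 ∧ d₁ = 0 := by omega
    decide
  have e1 : 2 ^ (n + 1) = 2 * 2 ^ n := by ring
  have e2 : 2 ^ (n + 1 + 1) = 4 * 2 ^ n := by ring
  rw [e1] at hdm hum
  rw [e2] at hu₁ hd₀
  obtain ⟨a, rfl⟩ := Nat.exists_eq_add_of_le (show 2 * 2 ^ n ≤ u₁ by omega)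
  obtain ⟨b, rfl⟩ := Nat.exists_eq_add_of_le (show 2 * 2 ^ n ≤ d₀ by omega)
  rw [add_comm u₀]
  refine crossMax_add_le_of_straddle (fun {p q} hp hq => ?_) (by omega) (by omega) (by omega)
    (by omega)
  have h := IH n (by omega) hp (Nat.zero_le q) le_rfl hq
  rwa [crossMax_zero_right] at h

lemma two_mul_crossMax_le {n u d : ℕ} (hu : u ≤ 2 ^ n) (hd : d ≤ 2 ^ n) :
    2 * crossMax n u d ≤ crossMax (n + 1) (u + d) (u + d) := by
  rcases le_total u d with h | h
  · have h1 := crossMax_add_le h h hd hd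
    rw [crossMax_comm hd hu, add_comm d u] at h1
    omega
  · have h1 := crossMax_add_le h h hu hu
    rw [crossMax_comm hd hu, add_comm d u] at h1
    omega

lemma crossMax_diag_of_le {n a : ℕ} (ha : a ≤ 2 ^ (n + 1)) :
    crossMax (n + 2) a a = crossMax n (a / 2) (a / 2) := by
  rw [crossMax_succ_of_le _ ha, crossMax_succ_of_le' (by rw [pow_succ] at ha; omega) ha]

lemma crossMax_diag_add {n a : ℕ} (ha : a ≤ 2 ^ (n + 1)) :
    crossMax (n + 2) (2 ^ (n + 1) + a) (2 ^ (n + 1) + a) =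
      2 ^ n + 2 * (a / 2) + crossMax n ((a + 1) / 2) ((a + 1) / 2) := by
  have e1 : 2 ^ (n + 1) = 2 * 2 ^ n := by ring
  have e2 : 2 ^ (n + 1 + 1) = 4 * 2 ^ n := by ring
  rw [crossMax_succ_add a (by omega),
    show (2 ^ (n + 1) + a + 1) / 2 = 2 ^ n + (a + 1) / 2 by omega,
    crossMax_succ_add' (by omega) ha]
  omega

lemma crossMax_diag_le_step {κ j k : ℕ} (hκ : κ * 2 ^ j = 2 ^ k)
    (ih : ∀ s t : ℕ, s < 2 ^ (j + 1) → t ≤ 2 ^ k →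
      crossMax (k + j + 1) (2 ^ k * s + t) (2 ^ k * s + t) ≤
        2 * (κ * (s ^ 2 / 4)) + 2 * crossMax k t (κ * ((s + 1) / 2)) + 1)
    {s t : ℕ} (hs : s < 2 ^ (j + 2)) (ht : t ≤ 2 ^ (k + 1)) :
    crossMax (k + j + 3) (2 ^ (k + 1) * s + t) (2 ^ (k + 1) * s + t) ≤
      2 * (κ * (s ^ 2 / 4)) + 2 * crossMax (k + 1) t (κ * ((s + 1) / 2)) + 1 := by
  have e1 : 2 ^ (k + 1) = 2 * 2 ^ k := by ring
  have e2 : 2 ^ (j + 1) = 2 * 2 ^ j := by ring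
  have e3 : 2 ^ (j + 2) = 4 * 2 ^ j := by ring
  have bound : ∀ r, r < 2 ^ (j + 1) → 2 ^ (k + 1) * r + t ≤ 2 ^ (k + j + 1 + 1) := by
    intro r hr
    calc 2 ^ (k + 1) * r + t ≤ 2 ^ (k + 1) * (r + 1) := by rw [mul_add_one]; omega
      _ ≤ 2 ^ (k + 1) * 2 ^ (j + 1) := Nat.mul_le_mul_left _ hr
      _ = 2 ^ (k + j + 1 + 1) := by ring
  rcases lt_or_ge s (2 ^ (j + 1)) with h | h
  · have hc : κ * ((s + 1) / 2) ≤ 2 ^ k := by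
      rw [← hκ]
      exact Nat.mul_le_mul_left _ (by omega)
    rw [crossMax_diag_of_le (bound s h), crossMax_succ_of_le _ hc,
      show (2 ^ (k + 1) * s + t) / 2 = 2 ^ k * s + t / 2 by rw [e1, mul_assoc]; omega]
    exact ih s (t / 2) h (by omega)
  · obtain ⟨r, rfl⟩ := Nat.exists_eq_add_of_le h
    have hr : r < 2 ^ (j + 1) := by omega
    rw [show 2 ^ (k + 1) * (2 ^ (j + 1) + r) + t = 2 ^ (k + j + 1 + 1) + (2 ^ (k + 1) * r + t) by
        ring, crossMax_diag_add (bound r hr),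
      show (2 ^ (k + 1) * r + t + 1) / 2 = 2 ^ k * r + (t + 1) / 2 by rw [e1, mul_assoc]; omega,
      show (2 ^ (k + 1) * r + t) / 2 = 2 ^ k * r + t / 2 by rw [e1, mul_assoc]; omega,
      show (2 ^ (j + 1) + r + 1) / 2 = 2 ^ j + (r + 1) / 2 by omega,
      show (2 ^ (j + 1) + r) ^ 2 / 4 = 2 ^ j * 2 ^ j + 2 ^ j * r + r ^ 2 / 4 by
        rw [show (2 ^ (j + 1) + r) ^ 2 = 4 * (2 ^ j * 2 ^ j + 2 ^ j * r) + r ^ 2 by ring]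
        omega,
      mul_add κ (2 ^ j), hκ, crossMax_succ_add _ ht,
      show κ * (2 ^ j * 2 ^ j + 2 ^ j * r + r ^ 2 / 4) =
        κ * 2 ^ j * 2 ^ j + κ * 2 ^ j * r + κ * (r ^ 2 / 4) by ring, hκ,
      show 2 ^ (k + j + 1) = 2 * (2 ^ k * 2 ^ j) by ring]
    have h1 := ih r ((t + 1) / 2) hr (by omega)
    omega

lemma crossMax_diag_le_even (k : ℕ) {s t : ℕ} (hs : s < 2 ^ (k + 1)) (ht : t ≤ 2 ^ k) :
    crossMax (k + k + 1) (2 ^ k * s + t) (2 ^ k * s + t) ≤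
      2 * (1 * (s ^ 2 / 4)) + 2 * crossMax k t (1 * ((s + 1) / 2)) + 1 := by
  induction k generalizing s t with
  | zero =>
    norm_num at hs ht
    interval_cases s <;> interval_cases t <;> decide
  | succ k ih =>
    have h := crossMax_diag_le_step (κ := 1) (j := k) (k := k) (one_mul _)
      (fun s t hs ht => ih hs ht) hs ht
    rwa [show k + 1 + (k + 1) + 1 = k + k + 3 by ring]

lemma crossMax_diag_le_odd (j : ℕ) {s t : ℕ} (hs : s < 2 ^ (j + 1)) (ht : t ≤ 2 ^ (j + 1)) :
    crossMax (j + 1 + j + 1) (2 ^ (j + 1) * s + t) (2 ^ (j + 1) * s + t) ≤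
      2 * (2 * (s ^ 2 / 4)) + 2 * crossMax (j + 1) t (2 * ((s + 1) / 2)) + 1 := by
  induction j generalizing s t with
  | zero =>
    norm_num at hs ht
    interval_cases s <;> interval_cases t <;> decide
  | succ j ih =>
    have h := crossMax_diag_le_step (κ := 2) (j := j) (k := j + 1) (by ring)
      (fun s t hs ht => ih hs ht) hs ht
    rwa [show j + 1 + 1 + (j + 1) + 1 = j + 1 + j + 3 by ring]

lemma crossMax_diag_le {κ j k : ℕ} (hκ : κ * 2 ^ j = 2 ^ k) (h12 : κ = 1 ∨ κ = 2) {s t : ℕ}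
    (hs : s < 2 ^ (j + 1)) (ht : t ≤ 2 ^ k) :
    crossMax (k + j + 1) (2 ^ k * s + t) (2 ^ k * s + t) ≤
      2 * (κ * (s ^ 2 / 4)) + 2 * crossMax k t (κ * ((s + 1) / 2)) + 1 := by
  rcases h12 with rfl | rfl
  · obtain rfl : j = k := Nat.pow_right_injective le_rfl (by simpa using hκ)
    exact crossMax_diag_le_even j hs ht
  · obtain rfl : j + 1 = k := Nat.pow_right_injective le_rfl (by simpa [pow_succ'] using hκ)
    exact crossMax_diag_le_odd j hs ht

lemma crossMax_box {j k a c t : ℕ} (ha : 2 ^ k * a + t ≤ 2 ^ (k + j)) (ht : t ≤ 2 ^ k)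
    (hc : c ≤ 2 ^ k) :
    crossMax (k + j) (2 ^ k * a + t) (2 ^ j * c) = a * c + crossMax k t c := by
  induction j generalizing a with
  | zero =>
    have hk : 0 < 2 ^ k := by positivity
    rcases Nat.eq_zero_or_pos a with rfl | h
    · simp
    · have h1 : 2 ^ k * 1 ≤ 2 ^ k * a := Nat.mul_le_mul_left _ h
      simp only [add_zero] at ha
      obtain rfl : a = 1 := by
        by_contra hne
        have : 2 ^ k * 2 ≤ 2 ^ k * a := Nat.mul_le_mul_left _ (by omega)
        omega
      obtain rfl : t = 0 := by omega
      simp [crossMax_zero_left, crossMax_pow_left hc]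
  | succ j ih =>
    have e : 2 ^ (j + 1) * c = 2 * (2 ^ j * c) := by ring
    have e2 : 2 ^ (k + j + 1) = 2 * 2 ^ (k + j) := by ring
    have e3 : 2 ^ (k + j) = 2 ^ k * 2 ^ j := by ring
    have hc' : 2 ^ j * c ≤ 2 ^ (k + j) := by
      rw [pow_add, mul_comm (2 ^ k)]
      exact Nat.mul_le_mul_left _ hc
    rw [← add_assoc] at ha ⊢
    rw [e]
    rcases lt_or_ge a (2 ^ j) with h | h
    · have h1 : 2 ^ k * a + t ≤ 2 ^ (k + j) := by
        have h2 : 2 ^ k * (a + 1) ≤ 2 ^ k * 2 ^ j := Nat.mul_le_mul_left _ h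
        rw [mul_add_one] at h2
        omega
      rw [crossMax_succ_of_le' h1 (by omega), Nat.mul_div_cancel_left _ two_pos, ih h1]
    · obtain ⟨b, rfl⟩ := Nat.exists_eq_add_of_le h
      have h1 : 2 ^ k * (2 ^ j + b) + t = 2 ^ (k + j) + (2 ^ k * b + t) := by ring
      rw [h1] at ha ⊢
      rw [crossMax_succ_add' (by omega) (by omega), Nat.mul_div_cancel_left _ two_pos,
        show (2 * (2 ^ j * c) + 1) / 2 = 2 ^ j * c by omega, ih (by omega)]
      ring

lemma delta_one (x : ℕ) : delta 1 x = x := by rw [delta]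

lemma delta_of_two_le {k : ℕ} (hk : 2 ≤ k) (x : ℕ) :
    delta k x = if x < k / 2 then 1 / 2 * delta (k / 2) x
      else 1 / 2 + 1 / 2 * delta ((k + 1) / 2) (x - k / 2) := by
  obtain ⟨k, rfl⟩ := Nat.exists_eq_add_of_le' hk
  rw [delta]

lemma delta_self {k : ℕ} (hk : 1 ≤ k) : delta k k = 1 := by
  induction k using Nat.strong_induction_on with
  | _ k ih =>
  rcases hk.eq_or_lt with rfl | h
  · simp [delta_one]
  · rw [delta_of_two_le h, if_neg (by omega), show k - k / 2 = (k + 1) / 2 by omega,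
      ih _ (by omega) (by omega)]
    norm_num

/-- `2 ^ k * delta c x` is the least `w` with `x ≤ crossMax k w c`. -/
lemma exists_delta_threshold {k c x : ℕ} (hc : 1 ≤ c) (hck : c ≤ 2 ^ k) (hx : x ≤ c) :
    ∃ t : ℕ, (t : ℚ) = 2 ^ k * delta c x ∧ t ≤ 2 ^ k ∧
      ∀ w ≤ 2 ^ k, x ≤ crossMax k w c ↔ t ≤ w := by
  induction k generalizing c x with
  | zero =>
    obtain rfl : c = 1 := by simpa using le_antisymm hck hc
    refine ⟨x, by simp [delta_one], by simpa using hx, fun w hw => ?_⟩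
    rw [show crossMax 0 w 1 = min w 1 from rfl]
    omega
  | succ k ih =>
    have e : 2 ^ (k + 1) = 2 * 2 ^ k := by ring
    have hpos : 1 ≤ 2 ^ k := Nat.one_le_two_pow
    rcases hc.eq_or_lt with rfl | h2
    · obtain ⟨t, ht, htk, h⟩ := ih le_rfl hpos hx
      refine ⟨2 * t, by push_cast; rw [ht]; ring, by omega, fun w hw => ?_⟩
      rw [crossMax_succ_of_le _ hpos, h _ (by omega)]
      omega
    have hsplit : ∀ w ≤ 2 ^ (k + 1), crossMax (k + 1) w c =
        crossMax k (min w (2 ^ k)) (c / 2) + crossMax k (w - 2 ^ k) ((c + 1) / 2) :=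
      fun w hw => crossMax_succ' hw hck
    rcases lt_or_ge x (c / 2) with hlt | hge
    · obtain ⟨t, ht, htk, h⟩ := ih (c := c / 2) (x := x) (by omega) (by omega) hlt.le
      refine ⟨t, by rw [ht, delta_of_two_le h2, if_pos hlt]; ring, by omega, fun w hw => ?_⟩
      rw [hsplit w hw]
      rcases le_total w (2 ^ k) with hwk | hwk
      · rw [min_eq_left hwk, Nat.sub_eq_zero_of_le hwk, crossMax_zero_left, add_zero, h w hwk]
      · rw [min_eq_right hwk, crossMax_pow_left (by omega)]
        omega
    · obtain ⟨t, ht, htk, h⟩ := ih (c := (c + 1) / 2) (x := x - c / 2) (by omega) (by omega)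
        (by omega)
      refine ⟨2 ^ k + t, ?_, by omega, fun w hw => ?_⟩
      · rw [delta_of_two_le h2, if_neg (by omega)]
        push_cast
        rw [ht]
        ring
      rw [hsplit w hw]
      rcases le_or_gt (2 ^ k) w with hwk | hwk
      · rw [min_eq_right hwk, crossMax_pow_left (by omega)]
        have := h (w - 2 ^ k) (by omega)
        omega
      · obtain ⟨t', ht', -, h'⟩ := ih (c := c / 2) (x := c / 2) (by omega) (by omega) le_rfl
        rw [delta_self (by omega), mul_one] at ht'
        have ht'' : t' = 2 ^ k := by exact_mod_cast ht'
        have := h' w hwk.le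
        rw [min_eq_left hwk.le, Nat.sub_eq_zero_of_le hwk.le, crossMax_zero_left]
        omega

lemma crossMax_lt_right {k c w : ℕ} (hc : 1 ≤ c) (hck : c ≤ 2 ^ k) (hw : w < 2 ^ k) :
    crossMax k w c < c := by
  obtain ⟨t, ht, -, h⟩ := exists_delta_threshold hc hck le_rfl
  rw [delta_self hc, mul_one] at ht
  have ht' : t = 2 ^ k := by exact_mod_cast ht
  have := h w hw.le
  omega

lemma sq_div_four_succ (s : ℕ) : (s + 1) ^ 2 / 4 = s ^ 2 / 4 + (s + 1) / 2 := by
  rcases Nat.even_or_odd' s with ⟨r, rfl | rfl⟩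
  · rw [show (2 * r + 1) ^ 2 = 4 * (r ^ 2 + r) + 1 by ring,
      show (2 * r) ^ 2 = 4 * r ^ 2 by ring]
    omega
  · rw [show (2 * r + 1 + 1) ^ 2 = 4 * (r ^ 2 + 2 * r + 1) by ring,
      show (2 * r + 1) ^ 2 = 4 * (r ^ 2 + r) + 1 by ring]
    omega

lemma le_add_of_le_crossMax {κ j k s x t m u d : ℕ} (hκ : κ * 2 ^ j = 2 ^ k)
    (h12 : κ = 1 ∨ κ = 2) (hs : 1 ≤ s) (hsj : s ≤ 2 ^ (j + 1)) (hsx : s = 2 ^ (j + 1) → x = 0)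
    (hm : m = κ * (s ^ 2 / 4) + x) (hm1 : 1 ≤ m) (htk : t ≤ 2 ^ k)
    (ht : ∀ w ≤ 2 ^ k, x ≤ crossMax k w (κ * ((s + 1) / 2)) ↔ t ≤ w)
    (hu : u ≤ 2 ^ (k + j)) (hd : d ≤ 2 ^ (k + j)) (h : m ≤ crossMax (k + j) u d) :
    2 ^ k * s + t ≤ u + d := by
  by_contra! hlt
  have h2 := two_mul_crossMax_le hu hd
  have e2 : 2 ^ (j + 1) = 2 * 2 ^ j := by ring
  rcases Nat.eq_zero_or_pos t with rfl | htpos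
  · obtain ⟨s, rfl⟩ := Nat.exists_eq_add_of_le' hs
    have h3 : crossMax (k + j + 1) (u + d) (u + d) ≤ _ :=
      (crossMax_mono (u' := 2 ^ k * s + (2 ^ k - 1)) (d' := 2 ^ k * s + (2 ^ k - 1))
        (by rw [mul_add_one] at hlt; omega) (by rw [mul_add_one] at hlt; omega)).trans
        (crossMax_diag_le hκ h12 (by omega) (by omega))
    rw [sq_div_four_succ, mul_add] at hm
    rcases Nat.eq_zero_or_pos s with rfl | hspos
    · have hN := crossMax_le_right k (2 ^ k - 1) (κ * ((0 + 1) / 2))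
      simp only [Nat.reduceDiv, Nat.reduceAdd, mul_zero, Nat.zero_pow two_pos] at *
      omega
    · have hN := crossMax_lt_right (k := k) (c := κ * ((s + 1) / 2)) (w := 2 ^ k - 1)
        (Nat.mul_pos (by omega) (by omega))
        (by rw [← hκ]; exact Nat.mul_le_mul_left _ (by omega))
        (Nat.sub_lt (by positivity) one_pos)
      omega
  · have hx : x ≠ 0 := by
      rintro rfl
      have := (ht 0 (Nat.zero_le _)).1 (Nat.zero_le _)
      omega
    have h3 : crossMax (k + j + 1) (u + d) (u + d) ≤ _ :=
      (crossMax_mono (u' := 2 ^ k * s + (t - 1)) (d' := 2 ^ k * s + (t - 1))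
        (by omega) (by omega)).trans
        (crossMax_diag_le hκ h12 (lt_of_le_of_ne hsj fun hh => hx (hsx hh)) (by omega))
    have := (ht (t - 1) (by omega)).1 (by omega)
    omega

/-- An up-set `U` and a down-set `D` in the power set of `X` meet in at most
`crossMax X.card U.card D.card` sets. -/
theorem card_inter_le_crossMax (X : Finset ℕ) {U D : Finset (Finset ℕ)}
    (hUX : U ⊆ X.powerset) (hDX : D ⊆ X.powerset)
    (hU : ∀ A ∈ U, ∀ B ⊆ X, A ⊆ B → B ∈ U) (hD : ∀ A ∈ D, ∀ B ⊆ A, B ∈ D) :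
    (U ∩ D).card ≤ crossMax X.card U.card D.card := by
  induction X using Finset.induction_on generalizing U D with
  | empty =>
    rw [card_empty]
    exact le_min (card_le_card inter_subset_left) (card_le_card inter_subset_right)
  | insert a X ha ih =>
    have key : ∀ {F : Finset (Finset ℕ)}, F ⊆ (insert a X).powerset →
        F.nonMemberSubfamily a ⊆ X.powerset ∧ F.memberSubfamily a ⊆ X.powerset := by
      intro F hF
      constructor <;> intro A hA
      · rw [mem_nonMemberSubfamily] at hA
        exact mem_powerset.2 ((subset_insert_iff_of_notMem hA.2).1 (mem_powerset.1 (hF hA.1)))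
      · rw [mem_memberSubfamily] at hA
        have := mem_powerset.1 (hF hA.1)
        exact mem_powerset.2 ((insert_subset_insert_iff hA.2).1 this)
    have hU0 : U.nonMemberSubfamily a ⊆ U.memberSubfamily a := by
      intro A hA
      have hAX := mem_powerset.1 ((key hUX).1 hA)
      rw [mem_nonMemberSubfamily] at hA
      exact mem_memberSubfamily.2
        ⟨hU A hA.1 _ (insert_subset_insert a hAX) (subset_insert a A), hA.2⟩
    have hD0 : D.memberSubfamily a ⊆ D.nonMemberSubfamily a := by
      intro A hA
      rw [mem_memberSubfamily] at hA
      exact mem_nonMemberSubfamily.2 ⟨hD _ hA.1 _ (subset_insert a A), hA.2⟩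
    have h0 := ih (key hUX).1 (key hDX).1
      (fun A hA B hB hAB => by
        rw [mem_nonMemberSubfamily] at hA ⊢
        exact ⟨hU A hA.1 B (hB.trans (subset_insert a X)) hAB, fun h => ha (hB h)⟩)
      (fun A hA B hB => by
        rw [mem_nonMemberSubfamily] at hA ⊢
        exact ⟨hD A hA.1 B hB, fun h => hA.2 (hB h)⟩)
    have h1 := ih (key hUX).2 (key hDX).2
      (fun A hA B hB hAB => by
        rw [mem_memberSubfamily] at hA ⊢
        exact ⟨hU _ hA.1 _ (insert_subset_insert a hB) (insert_subset_insert a hAB),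
          fun h => ha (hB h)⟩)
      (fun A hA B hB => by
        rw [mem_memberSubfamily] at hA ⊢
        exact ⟨hD _ hA.1 _ (insert_subset_insert a hB), fun h => hA.2 (hB h)⟩)
    have hc := crossMax_add_le (n := X.card) (card_le_card hU0) (card_le_card hD0)
      (by simpa using card_le_card (key hUX).2) (by simpa using card_le_card (key hDX).1)
    rw [card_insert_of_notMem ha, ← card_memberSubfamily_add_card_nonMemberSubfamily a U,
      ← card_memberSubfamily_add_card_nonMemberSubfamily a D,
      ← card_memberSubfamily_add_card_nonMemberSubfamily a (U ∩ D),
      memberSubfamily_inter, nonMemberSubfamily_inter,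
      add_comm (U.memberSubfamily a).card, add_comm (D.memberSubfamily a).card]
    omega

/-- The family consisting of `F` and of the sets `insert a A` with `A ∈ G`. -/
def glue (a : ℕ) (F G : Finset (Finset ℕ)) : Finset (Finset ℕ) :=
  F ∪ G.image (insert a)

section glue

variable {X : Finset ℕ} {a : ℕ} {F G F' G' : Finset (Finset ℕ)}

lemma mem_glue_of_notMem {A : Finset ℕ} (hA : a ∉ A) : A ∈ glue a F G ↔ A ∈ F := by
  simp only [glue, mem_union, mem_image, or_iff_left_iff_imp]
  rintro ⟨B, -, rfl⟩
  exact absurd (mem_insert_self a B) hA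

lemma mem_glue_of_mem (ha : a ∉ X) (hF : F ⊆ X.powerset) (hG : G ⊆ X.powerset) {A : Finset ℕ}
    (hA : a ∈ A) : A ∈ glue a F G ↔ A.erase a ∈ G := by
  simp only [glue, mem_union, mem_image]
  constructor
  · rintro (h | ⟨B, hB, rfl⟩)
    · exact absurd (mem_powerset.1 (hF h) hA) ha
    · rwa [erase_insert fun h => ha (mem_powerset.1 (hG hB) h)]
  · exact fun h => Or.inr ⟨_, h, insert_erase hA⟩

lemma glue_subset (hF : F ⊆ X.powerset) (hG : G ⊆ X.powerset) :
    glue a F G ⊆ (insert a X).powerset := by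
  refine union_subset (hF.trans (powerset_mono.2 (subset_insert a X))) ?_
  rintro _ h
  obtain ⟨B, hB, rfl⟩ := mem_image.1 h
  exact mem_powerset.2 (insert_subset_insert a (mem_powerset.1 (hG hB)))

lemma glue_mono (hF : F ⊆ F') (hG : G ⊆ G') : glue a F G ⊆ glue a F' G' :=
  union_subset_union hF (image_subset_image hG)

lemma card_glue (ha : a ∉ X) (hF : F ⊆ X.powerset) (hG : G ⊆ X.powerset) :
    (glue a F G).card = F.card + G.card := by
  rw [glue, card_union_of_disjoint, card_image_of_injOn]
  · intro A hA B hB h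
    have hA' : a ∉ A := fun h => ha (mem_powerset.1 (hG hA) h)
    have hB' : a ∉ B := fun h => ha (mem_powerset.1 (hG hB) h)
    rw [← erase_insert hA', ← erase_insert hB']
    exact congrArg (erase · a) h
  · rw [disjoint_left]
    rintro _ hA h
    obtain ⟨B, -, rfl⟩ := mem_image.1 h
    exact ha (mem_powerset.1 (hF hA) (mem_insert_self a B))

lemma glue_inter_glue (ha : a ∉ X) (hF : F ⊆ X.powerset) (hG : G ⊆ X.powerset)
    (hF' : F' ⊆ X.powerset) (hG' : G' ⊆ X.powerset) :
    glue a F G ∩ glue a F' G' = glue a (F ∩ F') (G ∩ G') := by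
  ext A
  rw [mem_inter]
  by_cases hA : a ∈ A
  · rw [mem_glue_of_mem ha hF hG hA, mem_glue_of_mem ha hF' hG' hA,
      mem_glue_of_mem ha (inter_subset_left.trans hF) (inter_subset_left.trans hG) hA, mem_inter]
  · rw [mem_glue_of_notMem hA, mem_glue_of_notMem hA, mem_glue_of_notMem hA, mem_inter]

end glue

/-- The bound `crossMax` is attained, by nested families of up-sets and down-sets. -/
theorem exists_card_inter_eq_crossMax (X : Finset ℕ) :
    ∃ U D : ℕ → Finset (Finset ℕ),
      (∀ u ≤ 2 ^ X.card, U u ⊆ X.powerset ∧ (U u).card = u ∧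
        (∀ A ∈ U u, ∀ B ⊆ X, A ⊆ B → B ∈ U u) ∧ ∀ v ≤ u, U v ⊆ U u) ∧
      (∀ d ≤ 2 ^ X.card, D d ⊆ X.powerset ∧ (D d).card = d ∧
        (∀ A ∈ D d, ∀ B ⊆ A, B ∈ D d) ∧ ∀ e ≤ d, D e ⊆ D d) ∧
      ∀ u ≤ 2 ^ X.card, ∀ d ≤ 2 ^ X.card,
        (U u ∩ D d).card = crossMax X.card u d := by
  induction X using Finset.induction_on with
  | empty =>
    refine ⟨fun u => if u = 0 then ∅ else {∅}, fun u => if u = 0 then ∅ else {∅}, ?_, ?_, ?_⟩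
    · intro u hu
      rw [card_empty, pow_zero] at hu
      interval_cases u <;> simp [subset_empty, em]
    · intro u hu
      rw [card_empty, pow_zero] at hu
      interval_cases u <;> simp [subset_empty, em]
    · intro u hu d hd
      rw [card_empty, pow_zero] at hu hd
      interval_cases u <;> interval_cases d <;> simp [crossMax]
  | insert a X ha ih =>
    obtain ⟨U, D, hU, hD, hUD⟩ := ih
    rw [card_insert_of_notMem ha]
    have e : 2 ^ (X.card + 1) = 2 * 2 ^ X.card := by ring
    refine ⟨fun u => glue a (U (u / 2)) (U ((u + 1) / 2)),
      fun d => glue a (D (min d (2 ^ X.card))) (D (d - 2 ^ X.card)), ?_, ?_, ?_⟩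
    · intro u hu
      obtain ⟨h1, h2, h3, h4⟩ := hU (u / 2) (by omega)
      obtain ⟨k1, k2, k3, k4⟩ := hU ((u + 1) / 2) (by omega)
      refine ⟨glue_subset h1 k1, by rw [card_glue ha h1 k1, h2, k2]; omega, ?_,
        fun v hv => glue_mono (h4 _ (by omega)) (k4 _ (by omega))⟩
      intro A hA B hB hAB
      by_cases haB : a ∈ B
      · rw [mem_glue_of_mem ha h1 k1 haB]
        have hBX : B.erase a ⊆ X := by rwa [← subset_insert_iff]
        by_cases haA : a ∈ A
        · rw [mem_glue_of_mem ha h1 k1 haA] at hA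
          exact k3 _ hA _ hBX (erase_subset_erase a hAB)
        · rw [mem_glue_of_notMem haA] at hA
          exact k3 _ (k4 _ (by omega) hA) _ hBX (subset_erase.2 ⟨hAB, haA⟩)
      · have haA : a ∉ A := fun h => haB (hAB h)
        rw [mem_glue_of_notMem haA] at hA
        rw [mem_glue_of_notMem haB]
        exact h3 A hA B ((subset_insert_iff_of_notMem haB).1 hB) hAB
    · intro d hd
      obtain ⟨h1, h2, h3, h4⟩ := hD (min d (2 ^ X.card)) (by omega)
      obtain ⟨k1, k2, k3, k4⟩ := hD (d - 2 ^ X.card) (by omega)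
      refine ⟨glue_subset h1 k1, by rw [card_glue ha h1 k1, h2, k2]; omega, ?_,
        fun v hv => glue_mono (h4 _ (by omega)) (k4 _ (by omega))⟩
      intro A hA B hAB
      by_cases haA : a ∈ A
      · rw [mem_glue_of_mem ha h1 k1 haA] at hA
        by_cases haB : a ∈ B
        · rw [mem_glue_of_mem ha h1 k1 haB]
          exact k3 _ hA _ (erase_subset_erase a hAB)
        · rw [mem_glue_of_notMem haB]
          exact h3 _ (h4 _ (by omega) hA) _ (subset_erase.2 ⟨hAB, haB⟩)
      · have haB : a ∉ B := fun h => haA (hAB h)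
        rw [mem_glue_of_notMem haA] at hA
        rw [mem_glue_of_notMem haB]
        exact h3 A hA B hAB
    · intro u hu d hd
      have h1 := (hU (u / 2) (by omega)).1
      have h2 := (hU ((u + 1) / 2) (by omega)).1
      have h3 := (hD (min d (2 ^ X.card)) (by omega)).1
      have h4 := (hD (d - 2 ^ X.card) (by omega)).1
      rw [glue_inter_glue ha h1 h2 h3 h4, card_glue ha (inter_subset_left.trans h1)
        (inter_subset_left.trans h2), hUD _ (by omega) _ (by omega),
        hUD _ (by omega) _ (by omega), crossMax_succ]

lemma card_groundSet (n : ℕ) : (groundSet n).card = n := by simp [groundSet]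

lemma Phi_add_le {n m u d : ℕ} (hu : u ≤ 2 ^ n) (hd : d ≤ 2 ^ n) (hm : m ≤ crossMax n u d) :
    Phi n m + m ≤ u + d := by
  obtain ⟨U, D, hU, hD, hUD⟩ := exists_card_inter_eq_crossMax (groundSet n)
  rw [card_groundSet] at hU hD hUD
  obtain ⟨hU1, hU2, hU3, -⟩ := hU u hu
  obtain ⟨hD1, hD2, hD3, -⟩ := hD d hd
  obtain ⟨F, hF, hFm⟩ := exists_subset_card_eq (hm.trans_eq (hUD u hu d hd).symm)
  have hsub : udClo (groundSet n) F ⊆ U u ∪ D d := by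
    refine union_subset_union (fun S hS => ?_) (fun S hS => ?_)
    · obtain ⟨hS, A, hA, hAS⟩ := mem_filter.1 hS
      exact hU3 A (mem_inter.1 (hF hA)).1 S (mem_powerset.1 hS) hAS
    · obtain ⟨hS, A, hA, hAS⟩ := mem_filter.1 hS
      exact hD3 A (mem_inter.1 (hF hA)).2 S hAS
  have h1 : Phi n m ≤ (udClo (groundSet n) F).card :=
    Nat.sInf_le ⟨F, hF.trans (inter_subset_left.trans hU1), hFm, rfl⟩
  have h2 := card_le_card hsub
  have h3 := card_union_add_card_inter (U u) (D d)
  rw [hUD u hu d hd, hU2, hD2] at h3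
  omega

lemma exists_le_Phi_add {n m : ℕ} (hm : m ≤ 2 ^ n) :
    ∃ u ≤ 2 ^ n, ∃ d ≤ 2 ^ n, m ≤ crossMax n u d ∧ u + d ≤ Phi n m + m := by
  have hne : {k | ∃ F : Finset (Finset ℕ), F ⊆ (groundSet n).powerset ∧ F.card = m ∧
      (udClo (groundSet n) F).card = k}.Nonempty := by
    obtain ⟨F, hF, hFm⟩ := exists_subset_card_eq
      (show m ≤ (groundSet n).powerset.card by rwa [card_powerset, card_groundSet])
    exact ⟨_, F, hF, hFm, rfl⟩
  obtain ⟨F, hF, hFm, hk⟩ : ∃ F : Finset (Finset ℕ), F ⊆ (groundSet n).powerset ∧ F.card = m ∧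
    (udClo (groundSet n) F).card = Phi n m := Nat.sInf_mem hne
  set X := groundSet n with hX
  have hU : upClo X F ⊆ X.powerset := filter_subset _ _
  have hD : downClo X F ⊆ X.powerset := filter_subset _ _
  have hI := card_inter_le_crossMax X hU hD
    (fun A hA B hB hAB => by
      obtain ⟨hA, C, hC, hCA⟩ := mem_filter.1 hA
      exact mem_filter.2 ⟨mem_powerset.2 hB, C, hC, hCA.trans hAB⟩)
    (fun A hA B hAB => by
      obtain ⟨hA, C, hC, hCA⟩ := mem_filter.1 hA
      exact mem_filter.2 ⟨mem_powerset.2 (hAB.trans (mem_powerset.1 hA)), C, hC, hAB.trans hCA⟩)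
  have hFI : F ⊆ upClo X F ∩ downClo X F := fun A hA =>
    mem_inter.2 ⟨mem_filter.2 ⟨hF hA, A, hA, Subset.rfl⟩, mem_filter.2 ⟨hF hA, A, hA, Subset.rfl⟩⟩
  have h1 := card_le_card hFI
  have h2 := card_le_card (inter_subset_left : upClo X F ∩ downClo X F ⊆ upClo X F)
  have h3 := card_union_add_card_inter (upClo X F) (downClo X F)
  have h4 := card_le_card hU
  have h5 := card_le_card hD
  rw [card_powerset, hX, card_groundSet, ← hX] at h4 h5
  rw [hX, card_groundSet, ← hX] at hI
  rw [udClo] at hk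
  obtain ⟨r, hr⟩ := Nat.exists_eq_add_of_le h1
  obtain ⟨u, hu⟩ := Nat.exists_eq_add_of_le' (show r ≤ (upClo X F).card by omega)
  have h6 := crossMax_add_left_le n u (downClo X F).card r
  rw [← hu] at h6
  exact ⟨u, by omega, _, h5, by omega, by omega⟩

lemma Phi_add_eq {n m κ j k s x : ℕ} (hn : n = k + j) (hκ : κ * 2 ^ j = 2 ^ k)
    (h12 : κ = 1 ∨ κ = 2) (hs : 1 ≤ s) (hx : x < κ * ((s + 1) / 2))
    (hm : m = κ * (s ^ 2 / 4) + x) (hm1 : 1 ≤ m) (hmn : m ≤ 2 ^ n)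
    (hsj : (s + 1) / 2 ≤ 2 ^ j) :
    (Phi n m : ℚ) + m = 2 ^ k * (s + delta (κ * ((s + 1) / 2)) x) := by
  subst hn
  have hc : κ * ((s + 1) / 2) ≤ 2 ^ k := by
    rw [← hκ]
    exact Nat.mul_le_mul_left _ hsj
  obtain ⟨t, ht, htk, hw⟩ := exists_delta_threshold (k := k) (by omega) hc hx.le
  have e : 2 ^ (j + 1) = 2 * 2 ^ j := by ring
  have hsx : s = 2 ^ (j + 1) → x = 0 := by
    rintro rfl
    rw [show (2 ^ (j + 1)) ^ 2 = 4 * (2 ^ j * 2 ^ j) by ring,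
      Nat.mul_div_cancel_left _ (by norm_num), ← mul_assoc, hκ, ← pow_add] at hm
    omega
  obtain ⟨u, hu, d, hd, hN, hud⟩ := exists_le_Phi_add hmn
  have hlow := le_add_of_le_crossMax hκ h12 hs (by omega) hsx hm hm1 htk hw hu hd hN
  have hu' : 2 ^ k * (s / 2) + t ≤ 2 ^ (k + j) := by
    rcases eq_or_ne s (2 ^ (j + 1)) with h | h
    · have ht0 := (hw 0 (Nat.zero_le _)).1 (by rw [hsx h]; exact Nat.zero_le _)
      rw [h, e, Nat.mul_div_cancel_left _ two_pos, pow_add]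
      omega
    · have h1 : 2 ^ k * (s / 2 + 1) ≤ 2 ^ k * 2 ^ j := Nat.mul_le_mul_left _ (by omega)
      rw [mul_add_one] at h1
      rw [pow_add]
      omega
  have hbox := crossMax_box hu' htk hc
  have hd' : 2 ^ j * (κ * ((s + 1) / 2)) ≤ 2 ^ (k + j) := by
    rw [add_comm k j, pow_add]
    exact Nat.mul_le_mul_left _ hc
  have hsq : s / 2 * ((s + 1) / 2) = s ^ 2 / 4 := by
    rcases Nat.even_or_odd' s with ⟨r, rfl | rfl⟩
    · rw [show (2 * r) ^ 2 = 4 * (r * r) by ring, show 2 * r / 2 = r by omega,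
        show (2 * r + 1) / 2 = r by omega, Nat.mul_div_cancel_left _ (by norm_num)]
    · rw [show (2 * r + 1) ^ 2 = 4 * (r * (r + 1)) + 1 by ring, show (2 * r + 1) / 2 = r by omega,
        show (2 * r + 1 + 1) / 2 = r + 1 by omega]
      omega
  have hup := Phi_add_le (m := m) hu' hd' (by
    rw [hbox, hm, mul_left_comm, hsq]
    exact Nat.add_le_add_left ((hw t htk).2 le_rfl) _)
  have heq : Phi (k + j) m + m = 2 ^ k * s + t := by
    refine le_antisymm (hup.trans_eq ?_) (hlow.trans hud)
    rw [← mul_assoc, mul_comm (2 ^ j) κ, hκ, add_right_comm, ← mul_add,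
      show s / 2 + (s + 1) / 2 = s by omega]
  have := congrArg (Nat.cast : ℕ → ℚ) heq
  push_cast at this
  rw [this, ht]
  ring

/-- Theorem 3: with `κ = 1` for even `n` and `κ = 2` for odd `n`, and `c` the positive
integer with `κc(c-1) ≤ m < κc(c+1)`, we have
`Φ(n,m) = √(κ 2^n) (2c - 1 + 2 δ_{2κc}(m - κc(c-1))) - m`, where
`√(κ 2^n) = 2^((n + κ - 1)/2)` is an integer. -/
theorem stmt2 (n m : ℕ) (hm1 : 1 ≤ m) (hm2 : m ≤ 2 ^ n)
    (κ : ℕ) (hκ : κ = if Even n then 1 else 2)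
    (c : ℕ) (hc : 0 < c) (hc1 : κ * c * (c - 1) ≤ m) (hc2 : m < κ * c * (c + 1)) :
    (Phi n m : ℚ) =
      2 ^ ((n + κ - 1) / 2) * (2 * c - 1 + 2 * delta (2 * κ * c) (m - κ * c * (c - 1))) - m := by
  have h12 : κ = 1 ∨ κ = 2 := by split_ifs at hκ <;> simp [hκ]
  obtain ⟨j, k, hn, hpow, hk⟩ : ∃ j k, n = k + j ∧ κ * 2 ^ j = 2 ^ k ∧ (n + κ - 1) / 2 = k := by
    split_ifs at hκ with h
    · obtain ⟨r, rfl⟩ := h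
      exact ⟨r, r, rfl, by rw [hκ, one_mul], by omega⟩
    · obtain ⟨r, rfl⟩ := Nat.not_even_iff_odd.1 h
      exact ⟨r, r + 1, by ring, by rw [hκ, pow_succ'], by omega⟩
  obtain ⟨c, rfl⟩ : ∃ b, c = b + 1 := ⟨c - 1, by omega⟩
  rw [Nat.add_sub_cancel] at *
  have hcj : c + 1 ≤ 2 ^ j := by
    by_contra! hlt
    have h1 : κ * (2 ^ j + 1) * 2 ^ j ≤ κ * (c + 1) * c := by gcongr <;> omega
    have h2 : κ * (2 ^ j + 1) * 2 ^ j = 2 ^ n + 2 ^ k := by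
      rw [mul_right_comm, hpow, hn]
      ring
    have h3 : 0 < 2 ^ k := by positivity
    omega
  have hκc : 1 ≤ κ * (c + 1) := Nat.mul_pos (by omega) hc
  obtain ⟨x, rfl⟩ := Nat.exists_eq_add_of_le hc1
  rw [hk, Nat.add_sub_cancel_left, eq_sub_iff_add_eq, delta_of_two_le (by rw [mul_assoc]; omega),
    show 2 * κ * (c + 1) / 2 = κ * (c + 1) by rw [mul_assoc, Nat.mul_div_cancel_left _ two_pos],
    show (2 * κ * (c + 1) + 1) / 2 = κ * (c + 1) by rw [mul_assoc]; omega]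
  split_ifs with hx
  · have e1 : (2 * c + 1 + 1) / 2 = c + 1 := by omega
    have e2 : (2 * c + 1) ^ 2 / 4 = (c + 1) * c := by
      rw [show (2 * c + 1) ^ 2 = 4 * ((c + 1) * c) + 1 by ring]
      omega
    rw [Phi_add_eq (s := 2 * c + 1) (x := x) hn hpow h12 (by omega) (by rwa [e1])
      (by rw [e2, mul_assoc]) hm1 hm2 (by rwa [e1]), e1]
    push_cast
    ring
  · obtain ⟨y, rfl⟩ := Nat.exists_eq_add_of_le (not_lt.1 hx)
    have e1 : (2 * (c + 1) + 1) / 2 = c + 1 := by omega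
    have e2 : (2 * (c + 1)) ^ 2 / 4 = (c + 1) * c + (c + 1) := by
      rw [show (2 * (c + 1)) ^ 2 = 4 * ((c + 1) * c + (c + 1)) by ring]
      omega
    rw [Phi_add_eq (s := 2 * (c + 1)) (x := y) hn hpow h12 (by omega)
      (by rw [e1]; nlinarith) (by rw [e2]; ring) hm1 hm2 (by rwa [e1]), e1,
      Nat.add_sub_cancel_left]
    push_cast
    ring
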